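/- arXiv:2307.14975 — 4 statements merged into one kernel-verified Lean document; each statement's English description precedes it below -/
import Mathlib

section
/- Fix s>0, N∈ℕ, reals ρ_l<ρ_r, and η∈ℕ^N. Then the nested integral ∫_{ρ_l}^{ρ_r}dθ_1 ∫_{θ_1}^{ρ_r}dθ_2 ⋯ ∫_{θ_{N−1}}^{ρ_r}dθ_N [∏_{i=1}^{N+1}(θ_i−θ_{i−1})^{2s−1}] · [∏_{i=1}^{N}(θ_i−ρ_r)^{η_i}] (with conventions θ_0=ρ_l, θ_{N+1}=ρ_r) equals (ρ_l−ρ_r)^{|η|} · (ρ_r−ρ_l)^{2s(N+1)−1} · [Γ(2s)^{N+1}/Γ(2s(N+1)+|η|)] · ∏_{k=1}^{N} Γ(2s(N−k+1)+Σ_{i=k}^{N}η_i)/Γ(2s(N−k+1)+Σ_{i=k+1}^{N}η_i), where |η| = Σ_{i=1}^{N} η_i. -/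
/-- The ordered simplex `{θ : ρ_l ≤ θ_1 ≤ θ_2 ≤ … ≤ θ_N ≤ ρ_r}`, the region of the nested
integral `∫_{ρ_l}^{ρ_r}dθ_1 ∫_{θ_1}^{ρ_r}dθ_2 ⋯ ∫_{θ_{N−1}}^{ρ_r}dθ_N`. -/
def simplexSet (N : ℕ) (ρl ρr : ℝ) : Set (Fin N → ℝ) :=
  {θ | (∀ i j : Fin N, i ≤ j → θ i ≤ θ j) ∧ ∀ i, ρl ≤ θ i ∧ θ i ≤ ρr}

/-- The extended chain `(θ_0, θ_1, …, θ_N, θ_{N+1})` with the conventions `θ_0 = ρ_l`,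
`θ_{N+1} = ρ_r`. -/
noncomputable def chainExt (ρl ρr : ℝ) {N : ℕ} (θ : Fin N → ℝ) : Fin (N + 2) → ℝ :=
  Fin.snoc (Fin.cons ρl θ) ρr

/-- The product of the consecutive gaps: `∏_{i=1}^{N+1} (θ_i − θ_{i−1})^{2s−1}` with the
conventions `θ_0 = ρ_l`, `θ_{N+1} = ρ_r`. -/
noncomputable def gapProd (s ρl ρr : ℝ) {N : ℕ} (θ : Fin N → ℝ) : ℝ :=
  ∏ i : Fin (N + 1),
    (chainExt ρl ρr θ i.succ - chainExt ρl ρr θ i.castSucc) ^ (2 * s - 1)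

open MeasureTheory Set

theorem lintegral_Ioo_rpow_mul_rpow {u v p q : ℝ} (hu : 0 < u) (hv : 0 < v) (hpq : p < q) :
    ∫⁻ x in Ioo p q, ENNReal.ofReal ((x - p) ^ (u - 1) * (q - x) ^ (v - 1)) =
      ENNReal.ofReal ((q - p) ^ (u + v - 1) * ProbabilityTheory.beta u v) := by
  have hL : 0 < q - p := sub_pos.2 hpq
  have hB := ProbabilityTheory.beta_pos hu hv
  have himage : Ioo p q = (fun x => (q - p) * x + p) '' Ioo 0 1 := by
    rw [Set.image_affine_Ioo hL]
    congr 1 <;> ring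
  have hpow : (q - p) ^ (u + v - 1) = (q - p) * ((q - p) ^ (u - 1) * (q - p) ^ (v - 1)) := by
    rw [show u + v - 1 = 1 + (u - 1) + (v - 1) by ring, Real.rpow_add hL, Real.rpow_add hL,
      Real.rpow_one, mul_assoc]
  have hderiv (x : ℝ) (_ : x ∈ Ioo (0 : ℝ) 1) :
      HasDerivWithinAt (fun x => (q - p) * x + p) (q - p) (Ioo 0 1) x := by
    simpa using (((hasDerivAt_id x).const_mul (q - p)).add_const p).hasDerivWithinAt
  have hinj : InjOn (fun x => (q - p) * x + p) (Ioo 0 1) := fun x _ y _ h => by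
    simpa [hL.ne'] using h
  have hone := ProbabilityTheory.lintegral_betaPDF_eq_one hu hv
  rw [ProbabilityTheory.lintegral_betaPDF] at hone
  rw [himage, lintegral_image_eq_lintegral_abs_deriv_mul measurableSet_Ioo hderiv hinj,
    ← mul_one (ENNReal.ofReal (_ * _)), ← hone, ← lintegral_const_mul _ (by fun_prop)]
  refine setLIntegral_congr_fun measurableSet_Ioo fun x hx => ?_
  rw [← ENNReal.ofReal_mul (abs_nonneg _), ← ENNReal.ofReal_mul (by positivity), abs_of_pos hL,
    hpow, show (q - p) * x + p - p = (q - p) * x by ring,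
    show q - ((q - p) * x + p) = (q - p) * (1 - x) by ring,
    Real.mul_rpow hL.le hx.1.le, Real.mul_rpow hL.le (sub_nonneg.2 hx.2.le)]
  congr 1
  field_simp

theorem cons_mem_simplexSet {N : ℕ} {ρl ρr x : ℝ} {θ : Fin N → ℝ} :
    (Fin.cons x θ : Fin (N + 1) → ℝ) ∈ simplexSet (N + 1) ρl ρr ↔
      x ∈ Icc ρl ρr ∧ θ ∈ simplexSet N x ρr := by
  constructor
  · rintro ⟨hmono, hmem⟩
    refine ⟨by simpa using hmem 0, fun i j hij => ?_, fun i => ⟨?_, ?_⟩⟩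
    · simpa using hmono i.succ j.succ (Fin.succ_le_succ_iff.2 hij)
    · simpa using hmono 0 i.succ (Fin.zero_le _)
    · simpa using (hmem i.succ).2
  · rintro ⟨⟨hl, hr⟩, hmono, hmem⟩
    refine ⟨fun i j => ?_, fun i => ?_⟩
    · cases i using Fin.cases <;> cases j using Fin.cases
      · simp
      · exact fun _ => by simpa using (hmem _).1
      · simp
      · simpa using hmono _ _
    · cases i using Fin.cases
      · exact ⟨hl, hr⟩
      · exact ⟨hl.trans (hmem _).1, (hmem _).2⟩

theorem gapProd_cons (s ρl ρr x : ℝ) {N : ℕ} (θ : Fin N → ℝ) :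
    gapProd s ρl ρr (Fin.cons x θ : Fin (N + 1) → ℝ) =
      (x - ρl) ^ (2 * s - 1) * gapProd s x ρr θ := by
  have hchain : chainExt ρl ρr (Fin.cons x θ : Fin (N + 1) → ℝ) =
      (Fin.cons ρl (chainExt x ρr θ) : Fin (N + 3) → ℝ) := by
    rw [chainExt, chainExt, Fin.cons_snoc_eq_snoc_cons]
  have hzero : chainExt x ρr θ 0 = x := by
    rw [chainExt, ← Fin.cons_snoc_eq_snoc_cons, Fin.cons_zero]
  rw [gapProd, gapProd, Fin.prod_univ_succ, hchain]
  simp only [Fin.cons_succ, Fin.castSucc_zero, Fin.cons_zero, ← Fin.succ_castSucc, hzero]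

theorem measurable_gapProd (s ρl ρr : ℝ) (N : ℕ) :
    Measurable fun θ : Fin N → ℝ => gapProd s ρl ρr θ := by
  have hchain (i : Fin (N + 2)) : Measurable fun θ : Fin N → ℝ => chainExt ρl ρr θ i := by
    simp only [chainExt]
    cases i using Fin.lastCases with
    | last => simp
    | cast i =>
      cases i using Fin.cases with
      | zero => simp only [Fin.snoc_castSucc, Fin.cons_zero]; fun_prop
      | succ i => simp only [Fin.snoc_castSucc, Fin.cons_succ]; fun_prop
  exact Finset.measurable_prod _ fun i _ => ((hchain _).sub (hchain _)).pow_const _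

theorem measurableSet_simplexSet (N : ℕ) (ρl ρr : ℝ) : MeasurableSet (simplexSet N ρl ρr) := by
  have : IsClosed (simplexSet N ρl ρr) := by
    simp only [simplexSet, ofPred_and, ofPred_forall]
    refine IsClosed.inter (isClosed_iInter fun i => isClosed_iInter fun j =>
      isClosed_iInter fun _ => isClosed_le (by fun_prop) (by fun_prop))
      (isClosed_iInter fun i => IsClosed.inter (isClosed_le (by fun_prop) (by fun_prop))
        (isClosed_le (by fun_prop) (by fun_prop)))
  exact this.measurableSet

theorem gapProd_nonneg (s : ℝ) {N : ℕ} {ρl ρr : ℝ} (hlr : ρl ≤ ρr) {θ : Fin N → ℝ}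
    (hθ : θ ∈ simplexSet N ρl ρr) : 0 ≤ gapProd s ρl ρr θ := by
  induction N generalizing ρl with
  | zero => simpa [gapProd, chainExt, Fin.snoc] using Real.rpow_nonneg (sub_nonneg.2 hlr) _
  | succ N ih =>
    rw [← Fin.cons_self_tail θ, cons_mem_simplexSet] at hθ
    rw [← Fin.cons_self_tail θ, gapProd_cons]
    exact mul_nonneg (Real.rpow_nonneg (sub_nonneg.2 hθ.1.1) _) (ih hθ.1.2 hθ.2)

/-- The Gamma-function factor of the nested integral. -/
noncomputable def nestedGamma (s : ℝ) {N : ℕ} (η : Fin N → ℕ) : ℝ :=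
  (Real.Gamma (2 * s) ^ (N + 1) /
      Real.Gamma (2 * s * ((N : ℝ) + 1) + ∑ i : Fin N, (η i : ℝ)))
    * ∏ k : Fin N,
      Real.Gamma (2 * s * ((N : ℝ) - (k : ℕ)) + ∑ i : Fin N, (if k ≤ i then (η i : ℝ) else 0))
        / Real.Gamma (2 * s * ((N : ℝ) - (k : ℕ)) + ∑ i : Fin N, (if k < i then (η i : ℝ) else 0))

theorem nestedGamma_nonneg {s : ℝ} (hs : 0 < s) {N : ℕ} (η : Fin N → ℕ) :
    0 ≤ nestedGamma s η := by
  have hsum (p : Fin N → Prop) [DecidablePred p] :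
      0 ≤ ∑ i : Fin N, (if p i then (η i : ℝ) else 0) :=
    Finset.sum_nonneg fun i _ => by positivity
  refine mul_nonneg (div_nonneg (pow_nonneg (Real.Gamma_nonneg_of_nonneg (by positivity)) _)
    (Real.Gamma_nonneg_of_nonneg (by positivity))) (Finset.prod_nonneg fun k _ => ?_)
  have hk : 0 ≤ 2 * s * ((N : ℝ) - (k : ℕ)) := by
    have : ((k : ℕ) : ℝ) ≤ N := by exact_mod_cast k.2.le
    exact mul_nonneg (by positivity) (sub_nonneg.2 this)
  exact div_nonneg (Real.Gamma_nonneg_of_nonneg (add_nonneg hk (hsum _)))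
    (Real.Gamma_nonneg_of_nonneg (add_nonneg hk (hsum _)))

theorem nestedGamma_succ {s : ℝ} (hs : 0 < s) {N : ℕ} (η : Fin (N + 1) → ℕ) :
    nestedGamma s η =
      ProbabilityTheory.beta (2 * s) (2 * s * ((N : ℝ) + 1) + ∑ i, (η i : ℝ)) *
        nestedGamma s (fun i => η i.succ) := by
  have h₁ : Real.Gamma (2 * s * ((N : ℝ) + 1) + ∑ i : Fin N, (η i.succ : ℝ)) ≠ 0 :=
    (Real.Gamma_pos_of_pos (by positivity)).ne'
  rw [nestedGamma, nestedGamma, ProbabilityTheory.beta, Fin.prod_univ_succ]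
  simp only [Fin.sum_univ_succ, Fin.zero_le, Fin.succ_le_succ_iff, Fin.succ_lt_succ_iff,
    Fin.val_zero, Fin.val_succ, if_true, lt_irrefl, if_false, Fin.succ_pos, Fin.not_lt_zero,
    Fin.le_zero_iff, Fin.succ_ne_zero, zero_add, Nat.cast_add, Nat.cast_one, Nat.cast_zero, sub_zero,
    add_sub_add_right_eq_sub]
  rw [show 2 * s + (2 * s * ((N : ℝ) + 1) + ((η 0 : ℝ) + ∑ i : Fin N, (η i.succ : ℝ))) =
    2 * s * ((N : ℝ) + 1 + 1) + ((η 0 : ℝ) + ∑ i : Fin N, (η i.succ : ℝ)) by ring]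
  field_simp
  ring

theorem lintegral_fin_cons {N : ℕ} {f : (Fin (N + 1) → ℝ) → ENNReal} (hf : Measurable f) :
    ∫⁻ θ, f θ = ∫⁻ x : ℝ, ∫⁻ θ : Fin N → ℝ, f (Fin.cons x θ) := by
  have he := (volume_preserving_piFinSuccAbove (fun _ : Fin (N + 1) => ℝ) 0).symm
  rw [← he.lintegral_comp hf, Measure.volume_eq_prod,
    lintegral_prod _ (by fun_prop)]
  simp [MeasurableEquiv.piFinSuccAbove_symm_apply, Fin.insertNthEquiv]

theorem lintegral_simplexSet {s : ℝ} (hs : 0 < s) {N : ℕ} {ρl ρr : ℝ} (hlr : ρl < ρr)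
    (η : Fin N → ℕ) :
    ∫⁻ θ in simplexSet N ρl ρr,
        ENNReal.ofReal (gapProd s ρl ρr θ * ∏ i, (ρr - θ i) ^ η i) =
      ENNReal.ofReal ((ρr - ρl) ^ (2 * s * ((N : ℝ) + 1) + ∑ i, (η i : ℝ) - 1) *
        nestedGamma s η) := by
  induction N generalizing ρl with
  | zero =>
    have huniv : simplexSet 0 ρl ρr = univ := by ext; simp [simplexSet]
    have hΓ : Real.Gamma (2 * s) ≠ 0 := (Real.Gamma_pos_of_pos (by positivity)).ne'
    rw [huniv, Measure.restrict_univ, volume_pi, Measure.pi_of_empty _ Fin.elim0, lintegral_dirac]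
    simp [nestedGamma, hΓ, gapProd, chainExt, Fin.snoc]
  | succ N ih =>
    have hmeas : Measurable fun θ : Fin (N + 1) → ℝ =>
        ENNReal.ofReal (gapProd s ρl ρr θ * ∏ i, (ρr - θ i) ^ η i) :=
      ((measurable_gapProd s ρl ρr _).mul (by fun_prop)).ennreal_ofReal
    have hS := measurableSet_simplexSet (N + 1) ρl ρr
    have hinner : ∀ x ∈ Ioo ρl ρr,
        (∫⁻ θ : Fin N → ℝ, (simplexSet (N + 1) ρl ρr).indicator (fun θ => ENNReal.ofReal
          (gapProd s ρl ρr θ * ∏ i, (ρr - θ i) ^ η i)) (Fin.cons x θ)) =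
        ENNReal.ofReal ((x - ρl) ^ (2 * s - 1) *
          (ρr - x) ^ ((2 * s * ((N : ℝ) + 1) + ∑ i, (η i : ℝ)) - 1)) *
            ENNReal.ofReal (nestedGamma s fun i => η i.succ) := by
      intro x hx
      have hl : 0 < x - ρl := sub_pos.2 hx.1
      have hr : 0 < ρr - x := sub_pos.2 hx.2
      have hc : 0 ≤ (x - ρl) ^ (2 * s - 1) * (ρr - x) ^ η 0 := by positivity
      have hpt (θ : Fin N → ℝ) : (simplexSet (N + 1) ρl ρr).indicator (fun θ => ENNReal.ofReal
            (gapProd s ρl ρr θ * ∏ i, (ρr - θ i) ^ η i)) (Fin.cons x θ) =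
          (simplexSet N x ρr).indicator (fun θ =>
            ENNReal.ofReal ((x - ρl) ^ (2 * s - 1) * (ρr - x) ^ η 0) *
            ENNReal.ofReal (gapProd s x ρr θ * ∏ i, (ρr - θ i) ^ η i.succ)) θ := by
        by_cases hθ : θ ∈ simplexSet N x ρr
        · rw [indicator_of_mem hθ,
            indicator_of_mem (cons_mem_simplexSet.2 ⟨Ioo_subset_Icc_self hx, hθ⟩),
            ← ENNReal.ofReal_mul hc, gapProd_cons, Fin.prod_univ_succ]
          simp only [Fin.cons_zero, Fin.cons_succ]
          congr 1
          ring
        · rw [indicator_of_notMem hθ, indicator_of_notMem fun h => hθ (cons_mem_simplexSet.1 h).2]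
      simp_rw [hpt]
      rw [lintegral_indicator (measurableSet_simplexSet _ _ _),
        lintegral_const_mul' _ _ ENNReal.ofReal_ne_top, ih hx.2, ← ENNReal.ofReal_mul hc,
        ← ENNReal.ofReal_mul (by positivity), Fin.sum_univ_succ,
        show 2 * s * ((N : ℝ) + 1) + ((η 0 : ℝ) + ∑ i : Fin N, (η i.succ : ℝ)) - 1 =
          (η 0 : ℝ) + (2 * s * ((N : ℝ) + 1) + ∑ i : Fin N, (η i.succ : ℝ) - 1) by ring,
        Real.rpow_add hr, Real.rpow_natCast]
      congr 1
      ring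
    have houter : ∀ x, x ∉ Icc ρl ρr →
        (∫⁻ θ : Fin N → ℝ, (simplexSet (N + 1) ρl ρr).indicator (fun θ => ENNReal.ofReal
          (gapProd s ρl ρr θ * ∏ i, (ρr - θ i) ^ η i)) (Fin.cons x θ)) = 0 := by
      intro x hx
      have hpt (θ : Fin N → ℝ) : (simplexSet (N + 1) ρl ρr).indicator (fun θ => ENNReal.ofReal
            (gapProd s ρl ρr θ * ∏ i, (ρr - θ i) ^ η i)) (Fin.cons x θ) = 0 :=
        indicator_of_notMem (fun h => hx (cons_mem_simplexSet.1 h).1) _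
      simp_rw [hpt, lintegral_zero]
    rw [← lintegral_indicator hS, lintegral_fin_cons (hmeas.indicator hS),
      ← setLIntegral_eq_of_support_subset (s := Icc ρl ρr),
      setLIntegral_congr Ioo_ae_eq_Icc.symm, setLIntegral_congr_fun measurableSet_Ioo hinner,
      lintegral_mul_const' _ _ ENNReal.ofReal_ne_top,
      lintegral_Ioo_rpow_mul_rpow (by positivity) (by positivity) hlr, nestedGamma_succ hs,
      ← ENNReal.ofReal_mul']
    · congr 1
      push_cast
      rw [← mul_assoc]
      ring_nf
    · exact nestedGamma_nonneg hs _
    · exact fun x hx => not_not.1 fun h => hx (houter x h)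

/-- Evaluation of the nested integral
`∫_{ρ_l}^{ρ_r}dθ_1 ⋯ ∫_{θ_{N−1}}^{ρ_r}dθ_N [∏_{i=1}^{N+1}(θ_i−θ_{i−1})^{2s−1}]·[∏_{i=1}^{N}(θ_i−ρ_r)^{η_i}]`
(with `θ_0 = ρ_l`, `θ_{N+1} = ρ_r`), expressed as an integral over the ordered simplex
(`k : Fin N` is 0-based, so the paper's `N−k+1` becomes `N−k`, `Σ_{i=k}^{N}` becomes `Σ_{i≥k}`
and `Σ_{i=k+1}^{N}` becomes `Σ_{i>k}`). -/
theorem nested_integral_eval (s : ℝ) (hs : 0 < s) (N : ℕ) (ρl ρr : ℝ) (hlr : ρl < ρr)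
    (η : Fin N → ℕ) :
    (∫ θ in simplexSet N ρl ρr,
        gapProd s ρl ρr θ * ∏ i : Fin N, (θ i - ρr) ^ (η i))
      = (ρl - ρr) ^ (∑ i : Fin N, η i) * (ρr - ρl) ^ (2 * s * ((N : ℝ) + 1) - 1)
        * (Real.Gamma (2 * s) ^ (N + 1) /
            Real.Gamma (2 * s * ((N : ℝ) + 1) + ∑ i : Fin N, (η i : ℝ)))
        * ∏ k : Fin N,
            Real.Gamma (2 * s * ((N : ℝ) - (k : ℕ)) + ∑ i : Fin N, (if k ≤ i then (η i : ℝ) else 0))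
              / Real.Gamma (2 * s * ((N : ℝ) - (k : ℕ)) + ∑ i : Fin N, (if k < i then (η i : ℝ) else 0)) := by
  have hL : 0 < ρr - ρl := sub_pos.2 hlr
  have hS := measurableSet_simplexSet N ρl ρr
  have hsign (θ : Fin N → ℝ) : gapProd s ρl ρr θ * ∏ i : Fin N, (θ i - ρr) ^ (η i) =
      (-1) ^ (∑ i, η i) * (gapProd s ρl ρr θ * ∏ i, (ρr - θ i) ^ η i) := by
    have (i : Fin N) : (θ i - ρr) ^ η i = (-1) ^ η i * (ρr - θ i) ^ η i := by
      rw [← mul_pow]; ring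
    simp_rw [this, Finset.prod_mul_distrib, Finset.prod_pow_eq_pow_sum]
    ring
  simp_rw [hsign]
  rw [integral_const_mul, integral_eq_lintegral_of_nonneg_ae
    (ae_restrict_of_forall_mem hS fun θ hθ => mul_nonneg (gapProd_nonneg s hlr.le hθ)
      (Finset.prod_nonneg fun i _ => pow_nonneg (sub_nonneg.2 (hθ.2 i).2) _))
    ((measurable_gapProd s ρl ρr N).mul (by fun_prop)).aestronglyMeasurable,
    lintegral_simplexSet hs hlr,
    ENNReal.toReal_ofReal (mul_nonneg (by positivity) (nestedGamma_nonneg hs η)), nestedGamma,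
    show 2 * s * ((N : ℝ) + 1) + ∑ i, (η i : ℝ) - 1 =
      ((∑ i, η i : ℕ) : ℝ) + (2 * s * ((N : ℝ) + 1) - 1) by push_cast; ring,
    Real.rpow_add hL, Real.rpow_natCast, show ρl - ρr = -1 * (ρr - ρl) by ring, mul_pow]
  ring
end

section
/- Fix s>0, N∈ℕ and c∈ℝ^N with |c_i|<1 for all i. Then Φ_N(c) = (Γ(2s(N+1))/Γ(2s)^{N+1}) · ∫_0^1 dt_1 ⋯ ∫_0^1 dt_N ∏_{i=1}^{N} t_i^{2s(N−i+1)−1} (1−t_i)^{2s−1} (1 − c_i ∏_{j=1}^{i} t_j)^{−2s}. -/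
/-- `𝒩_i^+(η) = Σ_{k=i}^{N} η_k` (0-based indexing: the sum of `η k` over `k ≥ i`). -/
def Nplus {N : ℕ} (η : Fin N → ℕ) (i : Fin N) : ℕ :=
  ∑ k : Fin N, if i ≤ k then η k else 0

/-- `Φ_N(c) = (Γ(2s(N+1))/Γ(2s)) · Σ_{η∈ℕ^N} ∏_{i=1}^{N} [ c_i^{η_i} · Γ(η_i+2s)/(Γ(2s)·η_i!) ·
Γ(2s(N+1−i)+𝒩_i^+(η))/Γ(2s(N+2−i)+𝒩_i^+(η)) ]` (here `i : Fin N` is 0-based, so the paper's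
`N+1−i` and `N+2−i` become `N−i` and `N+1−i`). -/
noncomputable def PhiFun (s : ℝ) {N : ℕ} (c : Fin N → ℝ) : ℝ :=
  (Real.Gamma (2 * s * ((N : ℝ) + 1)) / Real.Gamma (2 * s)) *
    ∑' η : Fin N → ℕ, ∏ i : Fin N,
      (c i ^ η i * (Real.Gamma ((η i : ℝ) + 2 * s) / (Real.Gamma (2 * s) * ((η i).factorial : ℝ)))
        * (Real.Gamma (2 * s * ((N : ℝ) - (i : ℕ)) + (Nplus η i : ℝ)) /
            Real.Gamma (2 * s * ((N : ℝ) + 1 - (i : ℕ)) + (Nplus η i : ℝ))))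

open MeasureTheory Set

/-- The product of absolutely summable families sums, over all multi-indices, to the product of the
sums. -/
lemma hasSum_fin_prod_and_summable_abs {ι : Type*} {N : ℕ} {f : Fin N → ι → ℝ} {S : Fin N → ℝ}
    (hS : ∀ i, HasSum (f i) (S i)) (hf : ∀ i, Summable fun n => |f i n|) :
    HasSum (fun η : Fin N → ι => ∏ i, f i (η i)) (∏ i, S i) ∧
      Summable fun η : Fin N → ι => ∏ i, |f i (η i)| := by
  induction N with
  | zero => exact ⟨by simp, .of_finite⟩
  | succ N ih =>
    obtain ⟨h1, h2⟩ := ih (f := fun i => f i.succ) (fun i => hS i.succ) (fun i => hf i.succ)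
    have habs := (hf 0).mul_of_nonneg h2 (fun _ => abs_nonneg _)
      (fun _ => Finset.prod_nonneg fun _ _ => abs_nonneg _)
    have hmul : Summable fun p : ι × (Fin N → ι) => f 0 p.1 * ∏ i, f i.succ (p.2 i) :=
      .of_norm (habs.congr fun p => by simp)
    let e : ι × (Fin N → ι) ≃ (Fin (N + 1) → ι) := Fin.consEquiv fun _ => ι
    constructor
    · have := (hS 0).mul h1 hmul
      rw [Fin.prod_univ_succ, ← e.hasSum_iff]
      have hfun : (fun p : ι × (Fin N → ι) => f 0 p.1 * ∏ i, f i.succ (p.2 i))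
          = (fun η : Fin (N + 1) → ι => ∏ i, f i (η i)) ∘ e := by
        funext p
        simp [e, Fin.prod_univ_succ]
      rwa [← hfun]
    · rw [← e.summable_iff]
      refine habs.congr fun p => ?_
      simp [e, Fin.prod_univ_succ]

/-- `Γ(n + a) / (Γ(a) n!)` is the binomial coefficient `(a + n - 1 choose n)`. -/
lemma Gamma_div_eq_ringChoose {a : ℝ} (ha : 0 < a) (n : ℕ) :
    Real.Gamma (n + a) / (Real.Gamma a * (n.factorial : ℝ)) = Ring.choose (a + n - 1) n := by
  have hG : Real.Gamma (n + a) = Real.Gamma a * (ascPochhammer ℝ n).eval a := by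
    induction n with
    | zero => simp
    | succ n ih =>
      have hna : (n : ℝ) + a ≠ 0 := by positivity
      rw [ascPochhammer_succ_right, Polynomial.eval_mul, ← mul_assoc, ← ih]
      have : ((n + 1 : ℕ) : ℝ) + a = (n + a) + 1 := by push_cast; ring
      rw [this, Real.Gamma_add_one hna]
      simp
      ring
  have hm := Ring.factorial_nsmul_multichoose_eq_ascPochhammer a n
  rw [Polynomial.ascPochhammer_smeval_eq_eval, Ring.multichoose_eq, nsmul_eq_mul] at hm
  have := (Real.Gamma_pos_of_pos ha).ne'
  have : (n.factorial : ℝ) ≠ 0 := by positivity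
  rw [hG, ← hm]
  field_simp

/-- Binomial series of `(1 - x) ^ (-a)` with Gamma function coefficients. -/
lemma hasSum_one_sub_rpow_neg {a : ℝ} (ha : 0 < a) {x : ℝ} (hx : |x| < 1) :
    HasSum (fun n : ℕ => x ^ n * (Real.Gamma (n + a) / (Real.Gamma a * (n.factorial : ℝ))))
      ((1 - x) ^ (-a)) := by
  have h := (Real.one_div_one_sub_rpow_hasFPowerSeriesOnBall_zero a).hasSum (y := x)
    (by simpa [enorm_eq_nnnorm, ← NNReal.coe_lt_coe] using hx)
  simp only [zero_add, FormalMultilinearSeries.ofScalars_apply_eq, smul_eq_mul] at h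
  rw [Real.rpow_neg (by linarith [(abs_lt.1 hx).2]), ← one_div]
  simp_rw [Gamma_div_eq_ringChoose ha, mul_comm (x ^ _)]
  exact h

lemma summable_abs_binomial_coeff {a : ℝ} (ha : 0 < a) {x : ℝ} (hx : |x| < 1) :
    Summable fun n : ℕ =>
      |x ^ n * (Real.Gamma (n + a) / (Real.Gamma a * (n.factorial : ℝ)))| := by
  refine (hasSum_one_sub_rpow_neg ha (x := |x|) (by simpa using hx)).summable.congr fun n => ?_
  have : 0 ≤ Real.Gamma (n + a) / (Real.Gamma a * (n.factorial : ℝ)) := by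
    have := Real.Gamma_pos_of_pos ha
    have := Real.Gamma_pos_of_pos (show 0 < (n : ℝ) + a by positivity)
    positivity
  rw [abs_mul, abs_of_nonneg this, abs_pow]

lemma integrableOn_Ioo_beta {a b : ℝ} (ha : 0 < a) (hb : 0 < b) :
    IntegrableOn (fun t : ℝ => t ^ (a - 1) * (1 - t) ^ (b - 1)) (Ioo 0 1) := by
  have h := Complex.betaIntegral_convergent (u := a) (v := b) (by simpa) (by simpa)
  rw [intervalIntegrable_iff_integrableOn_Ioo_of_le zero_le_one] at h
  refine (Integrable.re h).congr ?_
  refine ae_restrict_of_forall_mem measurableSet_Ioo fun x hx => ?_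
  beta_reduce
  norm_cast
  rw [← Complex.ofReal_cpow hx.1.le, ← Complex.ofReal_cpow (by linarith [hx.2])]
  norm_cast

lemma integral_Ioo_beta {a b : ℝ} (ha : 0 < a) (hb : 0 < b) :
    ∫ t in Ioo (0 : ℝ) 1, t ^ (a - 1) * (1 - t) ^ (b - 1)
      = Real.Gamma a * Real.Gamma b / Real.Gamma (a + b) := by
  have h := Complex.betaIntegral_convergent (u := a) (v := b) (by simpa) (by simpa)
  rw [intervalIntegrable_iff_integrableOn_Ioo_of_le zero_le_one] at h
  change _ = ProbabilityTheory.beta a b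
  rw [ProbabilityTheory.beta_eq_betaIntegralReal a b ha hb, Complex.betaIntegral,
    intervalIntegral.integral_of_le zero_le_one, integral_Ioc_eq_integral_Ioo,
    ← RCLike.re_to_complex, ← integral_re h]
  refine setIntegral_congr_fun measurableSet_Ioo fun x hx => ?_
  norm_cast
  rw [← Complex.ofReal_cpow hx.1.le, ← Complex.ofReal_cpow (by linarith [hx.2])]
  norm_cast

/-- Summation by parts for products: `∏ᵢ (∏_{j ≤ i} tⱼ) ^ ηᵢ = ∏ᵢ tᵢ ^ 𝒩ᵢ⁺(η)`. -/
lemma prod_partialProd_pow {N : ℕ} (η : Fin N → ℕ) (t : Fin N → ℝ) :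
    ∏ i, (∏ j, if j ≤ i then t j else 1) ^ η i = ∏ i, t i ^ Nplus η i := by
  simp_rw [← Finset.prod_pow, Nplus, ← Finset.prod_pow_eq_pow_sum]
  rw [Finset.prod_comm]
  refine Finset.prod_congr rfl fun j _ => Finset.prod_congr rfl fun i _ => ?_
  split_ifs <;> simp

/-- Integral representation of `Φ_N` (un-nested integrals): for `|c_i| < 1`,
`Φ_N(c) = (Γ(2s(N+1))/Γ(2s)^{N+1}) · ∫_{[0,1]^N} ∏_i t_i^{2s(N−i+1)−1}(1−t_i)^{2s−1}
(1−c_i ∏_{j=1}^i t_j)^{−2s} dt` (here `i, j : Fin N` are 0-based, so the paper's exponent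
`2s(N−i+1)−1` becomes `2s(N−i)−1` and `∏_{j=1}^{i} t_j` becomes `∏_{j ≤ i} t_j`). -/
theorem PhiFun_eq_integral (s : ℝ) (hs : 0 < s) (N : ℕ) (c : Fin N → ℝ)
    (hc : ∀ i, |c i| < 1) :
    PhiFun s c
      = (Real.Gamma (2 * s * ((N : ℝ) + 1)) / Real.Gamma (2 * s) ^ (N + 1)) *
        ∫ t in Set.univ.pi (fun _ : Fin N => Set.Icc (0 : ℝ) 1),
          ∏ i : Fin N,
            (t i ^ (2 * s * ((N : ℝ) - (i : ℕ)) - 1) * (1 - t i) ^ (2 * s - 1)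
              * (1 - c i * ∏ j : Fin N, (if j ≤ i then t j else 1)) ^ (-(2 * s))) := by
  obtain ⟨a, ha⟩ : ∃ a : Fin N → ℝ, ∀ i : Fin N, a i = 2 * s * ((N : ℝ) - (i : ℕ)) :=
    ⟨_, fun _ => rfl⟩
  have hb : 0 < 2 * s := by positivity
  have ha0 : ∀ i, 0 < a i := fun i => by
    have : ((i : ℕ) : ℝ) < N := by exact_mod_cast i.2
    rw [ha]; exact mul_pos hb (by linarith)
  have ha1 : ∀ i : Fin N, 2 * s * ((N : ℝ) + 1 - (i : ℕ)) = a i + 2 * s := fun i => by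
    rw [ha]; ring
  have han : ∀ i (n : ℕ), 0 < a i + n := fun i n => by have := ha0 i; positivity
  simp only [PhiFun, ← ha, ha1]
  generalize hbdef : 2 * s = b at *
  have hGb := (Real.Gamma_pos_of_pos hb).ne'
  set μ : Fin N → Measure ℝ := fun _ => volume.restrict (Ioo 0 1) with hμ
  set d : Fin N → ℕ → ℝ := fun i n =>
    c i ^ n * (Real.Gamma (n + b) / (Real.Gamma b * (n.factorial : ℝ))) with hd
  set w : Fin N → ℕ → ℝ → ℝ := fun i n t => t ^ (a i + n - 1) * (1 - t) ^ (b - 1) with hw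
  have hvol : (volume : Measure (Fin N → ℝ)).restrict (univ.pi fun _ => Icc (0 : ℝ) 1)
      = Measure.pi μ := by
    rw [volume_pi, Measure.restrict_pi_pi]
    simp only [hμ, Measure.restrict_congr_set Ioo_ae_eq_Icc]
  have hmem : ∀ᵐ t ∂Measure.pi μ, ∀ i, t i ∈ Ioo (0 : ℝ) 1 := by
    have : Measure.pi μ
        = (volume : Measure (Fin N → ℝ)).restrict (univ.pi fun _ => Ioo (0 : ℝ) 1) := by
      rw [volume_pi, Measure.restrict_pi_pi]
    rw [this]
    exact ae_restrict_of_forall_mem (.univ_pi fun _ => measurableSet_Ioo)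
      fun t ht i => ht i (mem_univ i)
  have hwint : ∀ i n, Integrable (w i n) (μ i) := fun i n => integrableOn_Ioo_beta (han i n) hb
  have hwval : ∀ i n, ∫ t, w i n t ∂μ i
      = Real.Gamma (a i + n) * Real.Gamma b / Real.Gamma (a i + n + b) :=
    fun i n => integral_Ioo_beta (han i n) hb
  have hwnonneg : ∀ i n, ∀ t ∈ Ioo (0 : ℝ) 1, 0 ≤ w i n t := fun i n t ht =>
    mul_nonneg (Real.rpow_nonneg ht.1.le _) (Real.rpow_nonneg (by linarith [ht.2]) _)
  have hwmono : ∀ i n, ∫ t, w i n t ∂μ i ≤ ∫ t, w i 0 t ∂μ i := fun i n => by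
    refine setIntegral_mono_on (hwint i n) (hwint i 0) measurableSet_Ioo fun t ht => ?_
    refine mul_le_mul_of_nonneg_right ?_ (Real.rpow_nonneg (by linarith [ht.2]) _)
    exact Real.rpow_le_rpow_of_exponent_ge ht.1 ht.2.le (by simp)
  have hwpos : ∀ i n, 0 ≤ ∫ t, w i n t ∂μ i := fun i n =>
    setIntegral_nonneg measurableSet_Ioo (hwnonneg i n)
  set F : (Fin N → ℕ) → (Fin N → ℝ) → ℝ := fun η t =>
    (∏ i, d i (η i)) * ∏ i, w i (Nplus η i) (t i) with hF
  have hFint : ∀ η, Integrable (F η) (Measure.pi μ) := fun η =>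
    (Integrable.fintype_prod fun i => hwint i (Nplus η i)).const_mul _
  have hdsum : ∀ i, Summable fun n => |d i n| := fun i => summable_abs_binomial_coeff hb (hc i)
  have hFval : ∀ η, ∫ t, F η t ∂Measure.pi μ
      = (∏ i, d i (η i)) * ∏ i, ∫ t, w i (Nplus η i) t ∂μ i := fun η => by
    rw [integral_const_mul, integral_fintype_prod_eq_prod]
  have hFnorm : ∀ η, ∫ t, ‖F η t‖ ∂Measure.pi μ
      = (∏ i, |d i (η i)|) * ∏ i, ∫ t, w i (Nplus η i) t ∂μ i := fun η => by
    rw [← integral_fintype_prod_eq_prod, ← integral_const_mul]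
    refine integral_congr_ae (hmem.mono fun t ht => ?_)
    have : 0 ≤ ∏ i, w i (Nplus η i) (t i) :=
      Finset.prod_nonneg fun i _ => hwnonneg i _ _ (ht i)
    simp only [hF, norm_mul, Real.norm_eq_abs, abs_of_nonneg this, Finset.abs_prod]
  have hFsum : Summable fun η => ∫ t, ‖F η t‖ ∂Measure.pi μ := by
    refine Summable.of_nonneg_of_le (fun η => integral_nonneg fun t => norm_nonneg _)
      (fun η => ?_) ((hasSum_fin_prod_and_summable_abs
        (fun i => (hdsum i).of_abs.hasSum) hdsum).2.mul_right (∏ i, ∫ t, w i 0 t ∂μ i))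
    rw [hFnorm]
    exact mul_le_mul_of_nonneg_left
      (Finset.prod_le_prod (fun i _ => hwpos i _) fun i _ => hwmono i _)
      (Finset.prod_nonneg fun _ _ => abs_nonneg _)
  have hFtsum : ∀ᵐ t ∂Measure.pi μ, ∑' η, F η t
      = ∏ i, (t i ^ (a i - 1) * (1 - t i) ^ (b - 1)
          * (1 - c i * ∏ j, (if j ≤ i then t j else 1)) ^ (-b)) := by
    filter_upwards [hmem] with t ht
    set P : Fin N → ℝ := fun i => ∏ j, (if j ≤ i then t j else 1)
    have hfac : ∀ i j, 0 ≤ (if j ≤ i then t j else 1) ∧ (if j ≤ i then t j else 1) ≤ 1 :=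
      fun i j => by split_ifs <;> simp [(ht j).1.le, (ht j).2.le]
    have hP0 : ∀ i, 0 ≤ P i := fun i => Finset.prod_nonneg fun j _ => (hfac i j).1
    have hP1 : ∀ i, P i ≤ 1 := fun i =>
      Finset.prod_le_one (fun j _ => (hfac i j).1) fun j _ => (hfac i j).2
    have hcP : ∀ i, |c i * P i| < 1 := fun i => by
      rw [abs_mul, abs_of_nonneg (hP0 i)]
      exact (mul_le_of_le_one_right (abs_nonneg _) (hP1 i)).trans_lt (hc i)
    have hser := (hasSum_fin_prod_and_summable_abs
      (fun i => hasSum_one_sub_rpow_neg hb (hcP i))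
      (fun i => summable_abs_binomial_coeff hb (hcP i))).1.mul_left
        (∏ i, (t i ^ (a i - 1) * (1 - t i) ^ (b - 1)))
    rw [Finset.prod_mul_distrib (f := fun i => t i ^ (a i - 1) * (1 - t i) ^ (b - 1)),
      ← hser.tsum_eq]
    refine tsum_congr fun η => ?_
    have hwt : ∀ i, w i (Nplus η i) (t i)
        = t i ^ Nplus η i * (t i ^ (a i - 1) * (1 - t i) ^ (b - 1)) := fun i => by
      have : a i + (Nplus η i : ℝ) - 1 = a i - 1 + (Nplus η i : ℝ) := by ring
      simp only [hw]
      rw [this, Real.rpow_add (ht i).1, Real.rpow_natCast]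
      ring
    simp only [hF, hd, hwt, mul_pow, Finset.prod_mul_distrib, ← prod_partialProd_pow]
    ring
  have key := (hasSum_integral_of_summable_integral_norm hFint hFsum).tsum_eq
  rw [integral_congr_ae hFtsum] at key
  rw [hvol, ← key, ← tsum_mul_left, ← tsum_mul_left]
  refine tsum_congr fun η => ?_
  have hterm : ∀ i, ∫ t, w i (Nplus η i) t ∂μ i = Real.Gamma b *
      (Real.Gamma (a i + Nplus η i) / Real.Gamma (a i + b + Nplus η i)) := fun i => by
    rw [hwval, add_right_comm]; ring
  rw [hFval]
  simp only [hterm, hd, Finset.prod_mul_distrib, Finset.prod_const, Finset.card_univ, Fintype.card_fin, pow_succ]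
  field_simp
end

section
/- Let s=1/2, N∈ℕ with N≥1, and c∈ℝ with 0<|c|<1. Then Φ_N evaluated at the constant vector (c,…,c) admits the closed form Φ_N(c,…,c) = ( −log(1−c)/c )^N. -/
/-- The weight `∏ i, 1 / (N - i + 𝒩_i^+(η))`, with `i` counted from `0`. -/
noncomputable def tailWeight {N : ℕ} (η : Fin N → ℕ) : ℝ :=
  ∏ i : Fin N, ((N : ℝ) - (i : ℕ) + Nplus η i)⁻¹

lemma tailWeight_nonneg {N : ℕ} (η : Fin N → ℕ) : 0 ≤ tailWeight η := by
  refine Finset.prod_nonneg fun i _ => inv_nonneg.2 ?_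
  have : ((i : ℕ) : ℝ) ≤ N := by exact_mod_cast i.2.le
  have : (0 : ℝ) ≤ Nplus η i := Nat.cast_nonneg _
  linarith

lemma Nplus_cons_zero {N : ℕ} (a : ℕ) (η : Fin N → ℕ) :
    Nplus (Fin.cons a η : Fin (N + 1) → ℕ) 0 = a + ∑ i, η i := by
  simp [Nplus, Fin.sum_univ_succ]

lemma Nplus_cons_succ {N : ℕ} (a : ℕ) (η : Fin N → ℕ) (i : Fin N) :
    Nplus (Fin.cons a η : Fin (N + 1) → ℕ) i.succ = Nplus η i := by
  simp [Nplus, Fin.sum_univ_succ]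

lemma tailWeight_cons {N : ℕ} (a : ℕ) (η : Fin N → ℕ) :
    tailWeight (Fin.cons a η : Fin (N + 1) → ℕ) =
      ((N : ℝ) + 1 + (a + ∑ i, η i : ℕ))⁻¹ * tailWeight η := by
  unfold tailWeight
  rw [Fin.prod_univ_succ, Nplus_cons_zero]
  simp only [Nplus_cons_succ]
  congr 1
  · simp
  · refine Finset.prod_congr rfl fun i _ => ?_
    congr 2
    push_cast [Fin.val_succ]
    ring

lemma sum_antidiagonalTuple_succ {M : Type*} [AddCommMonoid M] (k n : ℕ)
    (f : (Fin (k + 1) → ℕ) → M) :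
    ∑ η ∈ Finset.Nat.antidiagonalTuple (k + 1) n, f η =
      ∑ p ∈ Finset.HasAntidiagonal.antidiagonal n, ∑ η ∈ Finset.Nat.antidiagonalTuple k p.2,
        f (Fin.cons p.1 η) := by
  rw [Finset.sum_sigma']
  refine Finset.sum_bij' (fun η _ => ⟨(η 0, ∑ i, Fin.tail η i), Fin.tail η⟩)
    (fun x _ => Fin.cons x.1.1 x.2) ?_ ?_ ?_ ?_ ?_
  · intro η hη
    rw [Finset.Nat.mem_antidiagonalTuple, Fin.sum_univ_succ] at hη
    simpa [Finset.Nat.mem_antidiagonalTuple, Fin.tail] using hη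
  · rintro ⟨⟨a, b⟩, η⟩ h
    simp only [Finset.mem_sigma, Finset.HasAntidiagonal.mem_antidiagonal,
      Finset.Nat.mem_antidiagonalTuple] at h
    simp [Finset.Nat.mem_antidiagonalTuple, Fin.sum_univ_succ, h]
  · intro η _
    simp
  · rintro ⟨⟨a, b⟩, η⟩ h
    simp only [Finset.mem_sigma, Finset.Nat.mem_antidiagonalTuple] at h
    simp [h.2]
  · intro η _
    simp

/-- The power series of `-log (1 - X) / X`. -/
noncomputable def logSeries : PowerSeries ℝ :=
  PowerSeries.mk fun n => ((n : ℝ) + 1)⁻¹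

lemma coeff_X_mul_derivative (f : PowerSeries ℝ) (n : ℕ) :
    PowerSeries.coeff n (PowerSeries.X * PowerSeries.derivative ℝ f) =
      n * PowerSeries.coeff n f := by
  cases n with
  | zero => simp
  | succ n =>
    rw [PowerSeries.coeff_succ_X_mul, PowerSeries.coeff_derivative]
    push_cast
    ring

lemma logSeries_add_X_mul_derivative :
    logSeries + PowerSeries.X * PowerSeries.derivative ℝ logSeries =
      PowerSeries.mk fun _ => 1 := by
  ext n
  rw [map_add, coeff_X_mul_derivative]
  simp only [logSeries, PowerSeries.coeff_mk]
  field_simp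
  ring

lemma coeff_logSeries_pow_succ (N n : ℕ) :
    ((N : ℝ) + 1 + n) * PowerSeries.coeff n (logSeries ^ (N + 1)) =
      (N + 1) * ∑ p ∈ Finset.HasAntidiagonal.antidiagonal n, PowerSeries.coeff p.2 (logSeries ^ N) := by
  have h : ((N + 1 : ℕ) : PowerSeries ℝ) * logSeries ^ (N + 1) +
      PowerSeries.X * PowerSeries.derivative ℝ (logSeries ^ (N + 1)) =
      ((N + 1 : ℕ) : PowerSeries ℝ) * ((PowerSeries.mk fun _ => 1) * logSeries ^ N) := by
    rw [← logSeries_add_X_mul_derivative, Derivation.leibniz_pow]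
    simp only [Nat.add_sub_cancel, nsmul_eq_mul, smul_eq_mul]
    ring
  have h' := congrArg (PowerSeries.coeff n) h
  rw [map_add, coeff_X_mul_derivative, ← nsmul_eq_mul, ← nsmul_eq_mul (N + 1) (_ * _), map_nsmul, map_nsmul,
    PowerSeries.coeff_mul] at h'
  simp only [PowerSeries.coeff_mk, one_mul, nsmul_eq_mul] at h'
  push_cast at h'
  linarith

lemma factorial_mul_sum_tailWeight (N n : ℕ) :
    (N.factorial : ℝ) * ∑ η ∈ Finset.Nat.antidiagonalTuple N n, tailWeight η =
      PowerSeries.coeff n (logSeries ^ N) := by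
  induction N generalizing n with
  | zero =>
    cases n with
    | zero => simp [tailWeight]
    | succ n => simp [PowerSeries.coeff_one]
  | succ N ih =>
    have hpos : (N : ℝ) + 1 + n ≠ 0 := by positivity
    have key : ∑ η ∈ Finset.Nat.antidiagonalTuple (N + 1) n, tailWeight η =
        ((N : ℝ) + 1 + n)⁻¹ * ∑ p ∈ Finset.HasAntidiagonal.antidiagonal n,
          ∑ η ∈ Finset.Nat.antidiagonalTuple N p.2, tailWeight η := by
      rw [sum_antidiagonalTuple_succ, Finset.mul_sum]
      refine Finset.sum_congr rfl fun p hp => ?_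
      rw [Finset.mul_sum]
      refine Finset.sum_congr rfl fun η hη => ?_
      rw [tailWeight_cons, Finset.Nat.mem_antidiagonalTuple.1 hη, Finset.HasAntidiagonal.mem_antidiagonal.1 hp]
    have hrec := coeff_logSeries_pow_succ N n
    simp only [← ih, ← Finset.mul_sum] at hrec
    rw [key, Nat.factorial_succ]
    apply mul_left_cancel₀ hpos
    rw [hrec]
    push_cast
    field_simp

lemma hasSum_logSeries {c : ℝ} (hc0 : c ≠ 0) (hc1 : |c| < 1) :
    HasSum (fun n => PowerSeries.coeff n logSeries * c ^ n) (-Real.log (1 - c) / c) := by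
  refine ((Real.hasSum_pow_div_log_of_abs_lt_one hc1).div_const c).congr_fun ?_
  intro n
  simp only [logSeries, PowerSeries.coeff_mk]
  field_simp
  ring

lemma coeff_mul_mul_pow (f g : PowerSeries ℝ) (c : ℝ) (n : ℕ) :
    PowerSeries.coeff n (f * g) * c ^ n = ∑ p ∈ Finset.HasAntidiagonal.antidiagonal n,
      (PowerSeries.coeff p.1 f * c ^ p.1) * (PowerSeries.coeff p.2 g * c ^ p.2) := by
  rw [PowerSeries.coeff_mul, Finset.sum_mul]
  refine Finset.sum_congr rfl fun p hp => ?_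
  rw [← Finset.HasAntidiagonal.mem_antidiagonal.1 hp, pow_add]
  ring

lemma summable_norm_logSeries {c : ℝ} (hc1 : |c| < 1) :
    Summable fun n => ‖PowerSeries.coeff n logSeries * c ^ n‖ := by
  refine (summable_geometric_of_lt_one (abs_nonneg c) hc1).of_nonneg_of_le
    (fun _ => norm_nonneg _) fun n => ?_
  rw [norm_mul, norm_pow, Real.norm_eq_abs, Real.norm_eq_abs]
  refine mul_le_of_le_one_left (by positivity) ?_
  simp only [logSeries, PowerSeries.coeff_mk]
  rw [abs_of_nonneg (by positivity)]
  exact inv_le_one_of_one_le₀ (by simp)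

lemma summable_norm_logSeries_pow {c : ℝ} (hc1 : |c| < 1) (N : ℕ) :
    Summable fun n => ‖PowerSeries.coeff n (logSeries ^ N) * c ^ n‖ := by
  induction N with
  | zero =>
    refine summable_of_ne_finset_zero (s := {0}) fun n hn => ?_
    have : n ≠ 0 := by simpa using hn
    simp [PowerSeries.coeff_one, this]
  | succ N ih =>
    simp only [pow_succ logSeries, coeff_mul_mul_pow]
    exact summable_norm_sum_mul_antidiagonal_of_summable_norm
      (f := fun n => PowerSeries.coeff n (logSeries ^ N) * c ^ n)
      (g := fun n => PowerSeries.coeff n logSeries * c ^ n) ih (summable_norm_logSeries hc1)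

lemma tsum_logSeries_pow {c : ℝ} (hc0 : c ≠ 0) (hc1 : |c| < 1) (N : ℕ) :
    ∑' n, PowerSeries.coeff n (logSeries ^ N) * c ^ n = (-Real.log (1 - c) / c) ^ N := by
  induction N with
  | zero =>
    rw [tsum_eq_single 0 fun n hn => by simp [PowerSeries.coeff_one, hn]]
    simp
  | succ N ih =>
    simp only [pow_succ logSeries, coeff_mul_mul_pow]
    rw [← tsum_mul_tsum_eq_tsum_sum_antidiagonal_of_summable_norm
      (summable_norm_logSeries_pow hc1 N) (summable_norm_logSeries hc1), ih,
      (hasSum_logSeries hc0 hc1).tsum_eq, pow_succ]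

lemma tsum_antidiagonalTuple (c : ℝ) (N n : ℕ) :
    ∑' η : Finset.Nat.antidiagonalTuple N n,
      (N.factorial : ℝ) * (c ^ (∑ i, (η : Fin N → ℕ) i) * tailWeight (η : Fin N → ℕ)) =
      PowerSeries.coeff n (logSeries ^ N) * c ^ n := by
  rw [Finset.tsum_subtype (Finset.Nat.antidiagonalTuple N n)
    (fun η => (N.factorial : ℝ) * (c ^ (∑ i, η i) * tailWeight η)),
    ← factorial_mul_sum_tailWeight, mul_assoc, Finset.sum_mul, Finset.mul_sum]
  refine Finset.sum_congr rfl fun η hη => ?_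
  rw [Finset.Nat.mem_antidiagonalTuple.1 hη]
  ring

lemma factorial_mul_tsum_tailWeight {c : ℝ} (hc0 : c ≠ 0) (hc1 : |c| < 1) (N : ℕ) :
    (N.factorial : ℝ) * ∑' η : Fin N → ℕ, c ^ (∑ i, η i) * tailWeight η =
      (-Real.log (1 - c) / c) ^ N := by
  rw [← tsum_mul_left, ← (Finset.Nat.sigmaAntidiagonalTupleEquivTuple N).tsum_eq,
    ← tsum_logSeries_pow hc0 hc1]
  have hs : Summable fun x : (Σ n, Finset.Nat.antidiagonalTuple N n) =>
      (N.factorial : ℝ) * (c ^ (∑ i, (x.2 : Fin N → ℕ) i) * tailWeight (x.2 : Fin N → ℕ)) := by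
    refine Summable.of_norm ?_
    have habs : ∀ η : Fin N → ℕ, ‖(N.factorial : ℝ) * (c ^ (∑ i, η i) * tailWeight η)‖ =
        (N.factorial : ℝ) * (|c| ^ (∑ i, η i) * tailWeight η) := fun η => by
      simp [abs_of_nonneg (tailWeight_nonneg η)]
    simp only [habs]
    refine (summable_sigma_of_nonneg fun x => ?_).2 ⟨fun n => Summable.of_finite, ?_⟩
    · exact mul_nonneg (Nat.cast_nonneg _)
        (mul_nonneg (pow_nonneg (abs_nonneg c) _) (tailWeight_nonneg _))
    · simp only [tsum_antidiagonalTuple]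
      exact (summable_norm_logSeries_pow (c := |c|) (by rwa [abs_abs]) N).of_norm
  simp only [← tsum_antidiagonalTuple]
  exact hs.tsum_sigma

lemma PhiFun_half_summand (N : ℕ) (c : ℝ) (η : Fin N → ℕ) :
    ∏ i : Fin N,
      (c ^ η i * (Real.Gamma ((η i : ℝ) + 2 * (1 / 2)) /
          (Real.Gamma (2 * (1 / 2)) * ((η i).factorial : ℝ)))
        * (Real.Gamma (2 * (1 / 2) * ((N : ℝ) - (i : ℕ)) + (Nplus η i : ℝ)) /
            Real.Gamma (2 * (1 / 2) * ((N : ℝ) + 1 - (i : ℕ)) + (Nplus η i : ℝ)))) =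
      c ^ (∑ i, η i) * tailWeight η := by
  rw [tailWeight, ← Finset.prod_pow_eq_pow_sum, ← Finset.prod_mul_distrib]
  refine Finset.prod_congr rfl fun i _ => ?_
  have hi : ((i : ℕ) : ℝ) < N := by exact_mod_cast i.2
  have hpos : 0 < (N : ℝ) - (i : ℕ) + Nplus η i := by
    have : (0 : ℝ) ≤ Nplus η i := Nat.cast_nonneg _
    linarith
  have htwo : (2 : ℝ) * (1 / 2) = 1 := by norm_num
  have hshift : (N : ℝ) + 1 - (i : ℕ) + Nplus η i = (N : ℝ) - (i : ℕ) + Nplus η i + 1 := by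
    ring
  have hfac : ((η i).factorial : ℝ) ≠ 0 := by positivity
  rw [htwo, one_mul, one_mul, hshift, Real.Gamma_add_one hpos.ne', Real.Gamma_nat_eq_factorial,
    Real.Gamma_one, one_mul, div_self hfac, mul_one]
  have := (Real.Gamma_pos_of_pos hpos).ne'
  field_simp

/-- For `s = 1/2` and `0 < |c| < 1`, the constant-field specialization of `Φ_N` has the closed form
`Φ_N(c,…,c) = (−log(1−c)/c)^N`. -/
theorem PhiFun_const_half (N : ℕ) (hN : 1 ≤ N) (c : ℝ) (hc0 : 0 < |c|) (hc1 : |c| < 1) :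
    PhiFun (1 / 2) (fun _ : Fin N => c) = (-Real.log (1 - c) / c) ^ N := by
  rw [← factorial_mul_tsum_tailWeight (abs_pos.1 hc0) hc1]
  simp only [PhiFun, PhiFun_half_summand]
  congr 1
  have htwo : (2 : ℝ) * (1 / 2) = 1 := by norm_num
  rw [htwo, one_mul, Real.Gamma_one, Real.Gamma_nat_eq_factorial, div_one]
end

section
/- Let n∈ℕ and let U_1,…,U_n be i.i.d. random variables uniformly distributed on [0,1]; let U_{1,n} ≤ U_{2,n} ≤ … ≤ U_{n,n} denote their ascending order statistics (the nondecreasing rearrangement of (U_1,…,U_n)). Fix 1≤k≤n and indices 1 ≤ n_1 < n_2 < … < n_k ≤ n. Then the joint law of (U_{n_1,n},…,U_{n_k,n}) is absolutely continuous with respect to Lebesgue measure on ℝ^k, with density f(u_1,…,u_k) = n! · [∏_{i=1}^{k+1} (u_i−u_{i−1})^{n_i−n_{i−1}−1} / (n_i−n_{i−1}−1)!] · 1_{0 ≤ u_1 ≤ … ≤ u_k ≤ 1}, where by convention n_0=0, n_{k+1}=n+1, u_0=0 and u_{k+1}=1. Equivalently, the pushforward of the uniform product measure on [0,1]^n under the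 map u ↦ (sorted coordinates of u at positions n_1,…,n_k) equals f·(Lebesgue measure on ℝ^k). -/
open MeasureTheory

/-- The vector of ascending order statistics of `u : Fin n → ℝ`, i.e. the nondecreasing
rearrangement of `(u_1,…,u_n)`. -/
noncomputable def orderStat (n : ℕ) (u : Fin n → ℝ) : Fin n → ℝ :=
  u ∘ ⇑(Tuple.sort u)

/-- The extended index vector `(n_0, n_1, …, n_k, n_{k+1})` with the conventions `n_0 = 0` and
`n_{k+1} = n+1`; here `ns i : Fin n` is the 0-based position of the paper's 1-based index
`n_i = ns i + 1`. -/
def nsExt (n k : ℕ) (ns : Fin k → Fin n) : Fin (k + 2) → ℕ :=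
  Fin.snoc (Fin.cons 0 (fun i => (ns i : ℕ) + 1)) (n + 1)

/-- The extended vector `(u_0, u_1, …, u_k, u_{k+1})` with the conventions `u_0 = 0`,
`u_{k+1} = 1`. -/
noncomputable def uExt {k : ℕ} (u : Fin k → ℝ) : Fin (k + 2) → ℝ :=
  Fin.snoc (Fin.cons 0 u) 1

open Classical in
/-- The joint density of `(U_{n_1,n},…,U_{n_k,n})`:
`f(u_1,…,u_k) = n!·[∏_{i=1}^{k+1}(u_i−u_{i−1})^{n_i−n_{i−1}−1}/(n_i−n_{i−1}−1)!]·
1_{0 ≤ u_1 ≤ … ≤ u_k ≤ 1}`, with `n_0 = 0`, `n_{k+1} = n+1`, `u_0 = 0`, `u_{k+1} = 1`. -/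
noncomputable def osDensity (n k : ℕ) (ns : Fin k → Fin n) (u : Fin k → ℝ) : ℝ :=
  if (∀ i j : Fin k, i ≤ j → u i ≤ u j) ∧ (∀ i, 0 ≤ u i ∧ u i ≤ 1) then
    (n.factorial : ℝ) * ∏ i : Fin (k + 1),
      (uExt u i.succ - uExt u i.castSucc)
          ^ (nsExt n k ns i.succ - nsExt n k ns i.castSucc - 1)
        / (((nsExt n k ns i.succ - nsExt n k ns i.castSucc - 1).factorial : ℝ))
  else 0

open scoped ENNReal

/-- The function `x ↦ x₊ ^ m / m!`, with the convention `0 ^ 0 = 1`. -/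
noncomputable def truncPow (m : ℕ) (x : ℝ) : ℝ≥0∞ :=
  if 0 ≤ x then ENNReal.ofReal (x ^ m / m.factorial) else 0

/-- The product of the truncated powers of the increments of `w`, with exponents `m`. -/
noncomputable def chainDensity {k : ℕ} (m : Fin k → ℕ) (w : Fin (k + 1) → ℝ) : ℝ≥0∞ :=
  ∏ i, truncPow (m i) (w i.succ - w i.castSucc)

/-- The number of positions strictly between consecutive selected positions. -/
def gap (n k : ℕ) (ns : Fin k → Fin n) (i : Fin (k + 1)) : ℕ :=
  nsExt n k ns i.succ - nsExt n k ns i.castSucc - 1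

@[fun_prop]
lemma measurable_truncPow (m : ℕ) : Measurable (truncPow m) := by
  unfold truncPow
  exact Measurable.ite measurableSet_Ici (by fun_prop) measurable_const

@[fun_prop]
lemma measurable_chainDensity {k : ℕ} (m : Fin k → ℕ) : Measurable (chainDensity m) := by
  unfold chainDensity
  fun_prop

lemma chainDensity_cons {k : ℕ} (m : Fin (k + 1) → ℕ) (a : ℝ) (v : Fin (k + 1) → ℝ) :
    chainDensity m (Fin.cons a v : Fin (k + 2) → ℝ) =
      truncPow (m 0) (v 0 - a) * chainDensity (fun i => m i.succ) v := by
  simp [chainDensity, Fin.prod_univ_succ]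

lemma lintegral_truncPow_mul_truncPow (m : ℕ) (a b : ℝ) :
    ∫⁻ t, truncPow 0 (t - a) * truncPow m (b - t) = truncPow (m + 1) (b - a) := by
  have h : ∀ t, truncPow 0 (t - a) * truncPow m (b - t) =
      (Set.Icc a b).indicator (fun t => ENNReal.ofReal ((b - t) ^ m / m.factorial)) t := by
    intro t
    by_cases h1 : a ≤ t <;> by_cases h2 : t ≤ b <;> simp [truncPow, h1, h2]
  simp_rw [h]
  rw [lintegral_indicator measurableSet_Icc]
  by_cases hab : a ≤ b
  · rw [← ofReal_integral_eq_lintegral_ofReal, integral_Icc_eq_integral_Ioc,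
      ← intervalIntegral.integral_of_le hab]
    · have : ∫ t in a..b, (b - t) ^ m / (m.factorial : ℝ) =
          (b - a) ^ (m + 1) / ((m + 1).factorial : ℝ) := by
        rw [intervalIntegral.integral_div,
          intervalIntegral.integral_comp_sub_left (fun x => x ^ m), integral_pow,
          Nat.factorial_succ]
        push_cast
        simp [div_div]
      rw [this]
      simp [truncPow, hab]
    · exact (Continuous.integrableOn_Icc (by fun_prop))
    · refine (ae_restrict_mem measurableSet_Icc).mono fun t ht => ?_
      have : 0 ≤ b - t := by linarith [ht.2]
      simp only [Pi.zero_apply]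
      positivity
  · simp [truncPow, hab]

lemma lintegral_fin_succ {n : ℕ} {f : (Fin (n + 1) → ℝ) → ℝ≥0∞} (hf : Measurable f) :
    ∫⁻ x, f x = ∫⁻ t, ∫⁻ y : Fin n → ℝ, f (Fin.cons t y) := by
  rw [← ((volume_preserving_piFinSuccAbove (fun _ : Fin (n + 1) => ℝ) 0).symm).lintegral_comp hf]
  rw [Measure.volume_eq_prod, lintegral_prod]
  · simp [MeasurableEquiv.piFinSuccAbove, Fin.insertNthEquiv]
  · exact (hf.comp (MeasurableEquiv.measurable _)).aemeasurable

lemma measurable_cons {n : ℕ} :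
    Measurable fun p : ℝ × (Fin n → ℝ) => (Fin.cons p.1 p.2 : Fin (n + 1) → ℝ) := by
  refine measurable_pi_iff.2 fun i => ?_
  refine Fin.cases ?_ (fun j => ?_) i
  · simpa using measurable_fst
  · simpa using (by fun_prop : Measurable fun x : ℝ × (Fin n → ℝ) => x.2 j)

lemma measurable_cons_right {n : ℕ} (t : ℝ) :
    Measurable fun y : Fin n → ℝ => (Fin.cons t y : Fin (n + 1) → ℝ) :=
  measurable_cons.comp (measurable_const.prodMk measurable_id)

lemma measurable_snoc_one {n : ℕ} :
    Measurable fun p : Fin n → ℝ => (Fin.snoc p 1 : Fin (n + 1) → ℝ) := by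
  refine measurable_pi_iff.2 fun i => ?_
  refine Fin.lastCases ?_ (fun j => ?_) i
  · simp
  · simpa using measurable_pi_apply j

lemma nsExt_zero (n k : ℕ) (ns : Fin k → Fin n) : nsExt n k ns 0 = 0 := by
  simp [nsExt]

lemma nsExt_succ (n k : ℕ) (ns : Fin k → Fin n) (i : Fin (k + 1)) :
    nsExt n k ns i.succ = (Fin.snoc (fun i => (ns i : ℕ) + 1) (n + 1) : Fin (k + 1) → ℕ) i := by
  simp [nsExt, ← Fin.cons_snoc_eq_snoc_cons]

lemma nsExt_succ_comp_succ (n k : ℕ) (ns : Fin k → Fin n) (i : Fin (k + 1)) :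
    nsExt (n + 1) k (fun i => (ns i).succ) i.succ = nsExt n k ns i.succ + 1 := by
  rw [nsExt_succ, nsExt_succ]
  refine Fin.lastCases ?_ (fun j => ?_) i <;> simp

lemma nsExt_cons_succ (n k : ℕ) (ns : Fin k → Fin n) (i : Fin (k + 2)) :
    nsExt (n + 1) (k + 1) (Fin.cons 0 fun i => (ns i).succ) i.succ = nsExt n k ns i + 1 := by
  rw [nsExt_succ, nsExt]
  refine Fin.lastCases (by simp) (fun j => ?_) i
  rw [Fin.snoc_castSucc, Fin.snoc_castSucc]
  refine Fin.cases ?_ (fun j => ?_) j <;> simp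

lemma gap_succ_comp_zero (n k : ℕ) (ns : Fin k → Fin n) :
    gap (n + 1) k (fun i => (ns i).succ) 0 = gap n k ns 0 + 1 := by
  have h : 1 ≤ nsExt n k ns (Fin.succ 0) := by
    rw [nsExt_succ]
    refine Fin.lastCases ?_ (fun j => ?_) (0 : Fin (k + 1)) <;> simp
  simp only [gap, nsExt_succ_comp_succ, Fin.castSucc_zero, nsExt_zero]
  omega

lemma gap_succ_comp_succ (n k : ℕ) (ns : Fin k → Fin n) (i : Fin k) :
    gap (n + 1) k (fun i => (ns i).succ) i.succ = gap n k ns i.succ := by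
  simp only [gap, nsExt_succ_comp_succ, ← Fin.succ_castSucc]
  omega

lemma gap_cons_zero (n k : ℕ) (ns : Fin k → Fin n) :
    gap (n + 1) (k + 1) (Fin.cons 0 fun i => (ns i).succ) 0 = 0 := by
  rw [gap, nsExt_cons_succ, Fin.castSucc_zero, nsExt_zero, nsExt_zero]

lemma gap_cons_succ (n k : ℕ) (ns : Fin k → Fin n) (i : Fin (k + 1)) :
    gap (n + 1) (k + 1) (Fin.cons 0 fun i => (ns i).succ) i.succ = gap n k ns i := by
  simp only [gap, nsExt_cons_succ, ← Fin.succ_castSucc]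
  omega

theorem lintegral_chainDensity_marginal (n : ℕ) : ∀ (k : ℕ) (ns : Fin k → Fin n)
    (_ : StrictMono ns) (a : ℝ) (G : (Fin k → ℝ) → ℝ≥0∞) (_ : Measurable G),
    ∫⁻ x : Fin n → ℝ, G (fun i => x (ns i)) *
        chainDensity 0 (Fin.cons a (Fin.snoc x 1 : Fin (n + 1) → ℝ) : Fin (n + 2) → ℝ) =
      ∫⁻ y : Fin k → ℝ, G y *
        chainDensity (gap n k ns) (Fin.cons a (Fin.snoc y 1 : Fin (k + 1) → ℝ)) := by
  induction n with
  | zero =>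
    intro k ns hns a G hG
    obtain rfl : k = 0 := by
      rcases k with _ | k
      · rfl
      · exact (ns 0).elim0
    have : gap 0 0 ns = 0 := by ext i; simp [gap, nsExt, Fin.snoc]
    rw [this]
    congr! with x
  | succ n ih =>
    intro k ns hns a G hG
    have hm : Measurable fun x : Fin (n + 1) → ℝ => G (fun i => x (ns i)) *
        chainDensity 0 (Fin.cons a (Fin.snoc x 1 : Fin (n + 2) → ℝ) : Fin (n + 3) → ℝ) := by
      refine Measurable.mul (by fun_prop) ?_
      exact (measurable_chainDensity _).comp
        (measurable_cons.comp (measurable_const.prodMk measurable_snoc_one))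
    rw [lintegral_fin_succ hm]
    have key : ∀ (t : ℝ) (y : Fin n → ℝ),
        chainDensity 0 (Fin.cons a (Fin.snoc (Fin.cons t y : Fin (n + 1) → ℝ) 1 : Fin (n + 2) → ℝ) :
          Fin (n + 3) → ℝ) = truncPow 0 (t - a) *
          chainDensity 0 (Fin.cons t (Fin.snoc y 1 : Fin (n + 1) → ℝ) : Fin (n + 2) → ℝ) := by
      intro t y
      rw [chainDensity_cons, ← Fin.cons_snoc_eq_snoc_cons]
      rfl
    simp_rw [key]
    have hms : ∀ t : ℝ, Measurable fun y : Fin n → ℝ =>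
        chainDensity 0 (Fin.cons t (Fin.snoc y 1 : Fin (n + 1) → ℝ) : Fin (n + 2) → ℝ) := fun t =>
      (measurable_chainDensity _).comp
        (measurable_cons.comp (measurable_const.prodMk measurable_snoc_one))
    have hcase : (∃ ns' : Fin k → Fin n, StrictMono ns' ∧ ns = fun i => (ns' i).succ) ∨
        ∃ (k' : ℕ) (hk : k = k' + 1) (ns' : Fin k' → Fin n), StrictMono ns' ∧
          ns = fun i => (Fin.cons 0 fun i => (ns' i).succ : Fin (k' + 1) → Fin (n + 1))
            (Fin.cast hk i) := by
      by_cases h0 : ∀ i, ns i ≠ 0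
      · refine Or.inl ⟨fun i => (ns i).pred (h0 i), fun i j hij => ?_, by simp⟩
        simpa using hns hij
      · right
        push Not at h0
        obtain ⟨i, hi⟩ := h0
        rcases k with _ | k
        · exact i.elim0
        have hz : ns 0 = 0 := by
          have := hns.monotone (Fin.zero_le i)
          rw [hi] at this
          exact Fin.le_zero_iff.1 this
        have hp : ∀ i : Fin k, ns i.succ ≠ 0 := fun i => by
          have := hns (Fin.succ_pos i)
          rw [hz] at this
          exact this.ne'
        refine ⟨k, rfl, fun i => (ns i.succ).pred (hp i), fun i j hij => ?_, ?_⟩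
        · simpa using hns (Fin.succ_lt_succ_iff.2 hij)
        · funext i
          refine Fin.cases ?_ (fun j => ?_) i <;> simp [hz]
    rcases hcase with ⟨ns', hns', rfl⟩ | ⟨k, rfl, ns', hns', rfl⟩
    · have h1 : ∀ t : ℝ, ∫⁻ y : Fin n → ℝ,
          G (fun i => (Fin.cons t y : Fin (n + 1) → ℝ) (ns' i).succ) * (truncPow 0 (t - a) *
            chainDensity 0 (Fin.cons t (Fin.snoc y 1 : Fin (n + 1) → ℝ) : Fin (n + 2) → ℝ)) =
          ∫⁻ y : Fin k → ℝ, truncPow 0 (t - a) * (G y *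
            chainDensity (gap n k ns') (Fin.cons t (Fin.snoc y 1 : Fin (k + 1) → ℝ))) := by
        intro t
        simp only [Fin.cons_succ, mul_left_comm _ (truncPow 0 (t - a))]
        rw [lintegral_const_mul, lintegral_const_mul, ih k ns' hns' t G hG]
        · exact hG.mul ((measurable_chainDensity _).comp
            (measurable_cons.comp (measurable_const.prodMk measurable_snoc_one)))
        · exact Measurable.mul (by fun_prop) (hms t)
      simp_rw [h1]
      rw [lintegral_lintegral_swap]
      · refine lintegral_congr fun y => ?_
        simp only [chainDensity_cons]
        calc _ = ∫⁻ t, (G y * chainDensity (fun i => gap n k ns' i.succ) (Fin.snoc y 1)) *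
              (truncPow 0 (t - a) *
                truncPow (gap n k ns' 0) ((Fin.snoc y 1 : Fin (k + 1) → ℝ) 0 - t)) :=
              lintegral_congr fun t => by ring
          _ = _ := by
            rw [lintegral_const_mul _ (by fun_prop), lintegral_truncPow_mul_truncPow,
              gap_succ_comp_zero]
            simp_rw [gap_succ_comp_succ]
            ring
      · refine Measurable.aemeasurable ?_
        refine Measurable.mul (by fun_prop) (Measurable.mul (by fun_prop) ?_)
        exact (measurable_chainDensity _).comp
          (measurable_cons.comp (measurable_fst.prodMk (measurable_snoc_one.comp measurable_snd)))
    · rw [lintegral_fin_succ]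
      · refine lintegral_congr fun t => ?_
        have h2 : ∀ y : Fin n → ℝ, (fun i => (Fin.cons t y : Fin (n + 1) → ℝ)
            ((Fin.cons 0 fun i => (ns' i).succ : Fin (k + 1) → Fin (n + 1)) (Fin.cast rfl i))) =
            Fin.cons t fun i => y (ns' i) := by
          intro y
          funext i
          refine Fin.cases ?_ (fun j => ?_) i <;> simp
        simp_rw [h2, mul_left_comm _ (truncPow 0 (t - a))]
        rw [lintegral_const_mul, ih k ns' hns' t (fun y => G (Fin.cons t y)) (hG.comp (measurable_cons_right t)),
          ← lintegral_const_mul]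
        · refine lintegral_congr fun y => ?_
          rw [chainDensity_cons _ a, ← Fin.cons_snoc_eq_snoc_cons]
          simp only [Fin.cast_refl, id, gap_cons_zero, gap_cons_succ, Fin.cons_zero]
          ring
        · exact (hG.comp (measurable_cons_right t)).mul ((measurable_chainDensity _).comp
            (measurable_cons.comp (measurable_const.prodMk measurable_snoc_one)))
        · exact Measurable.mul ((hG.comp (measurable_cons_right t)).comp (by fun_prop)) (hms t)
      · exact hG.mul ((measurable_chainDensity _).comp
          (measurable_cons.comp (measurable_const.prodMk measurable_snoc_one)))

lemma chainDensity_of_monotone {k : ℕ} (m : Fin k → ℕ) {w : Fin (k + 1) → ℝ} (hw : Monotone w) :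
    chainDensity m w =
      ENNReal.ofReal (∏ i, (w i.succ - w i.castSucc) ^ m i / (m i).factorial) := by
  have h : ∀ i : Fin k, 0 ≤ w i.succ - w i.castSucc := fun i =>
    sub_nonneg.2 (hw i.castSucc_le_succ)
  rw [chainDensity, ENNReal.ofReal_prod_of_nonneg fun i _ => div_nonneg (pow_nonneg (h i) _)
    (Nat.cast_nonneg _)]
  exact Finset.prod_congr rfl fun i _ => by rw [truncPow, if_pos (h i)]

lemma chainDensity_of_not_monotone {k : ℕ} (m : Fin k → ℕ) {w : Fin (k + 1) → ℝ}
    (hw : ¬ Monotone w) : chainDensity m w = 0 := by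
  rw [Fin.monotone_iff_le_succ] at hw
  push Not at hw
  obtain ⟨i, hi⟩ := hw
  exact Finset.prod_eq_zero (Finset.mem_univ i) (by rw [truncPow, if_neg (by linarith)])

lemma monotone_uExt_iff {k : ℕ} (u : Fin k → ℝ) :
    Monotone (uExt u) ↔ Monotone u ∧ ∀ i, 0 ≤ u i ∧ u i ≤ 1 := by
  have hval : ∀ i : Fin k, uExt u i.succ.castSucc = u i := fun i => by
    rw [uExt, Fin.snoc_castSucc, Fin.cons_succ]
  have hzero : uExt u 0 = 0 := by simp [uExt]
  have hlast : uExt u (Fin.last _) = 1 := by simp [uExt]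
  constructor
  · refine fun h => ⟨fun i j hij => ?_, fun i => ⟨?_, ?_⟩⟩
    · rw [← hval i, ← hval j]
      exact h (by simpa using hij)
    · rw [← hval i, ← hzero]
      exact h (Fin.zero_le _)
    · rw [← hval i, ← hlast]
      exact h (Fin.le_last _)
  · rintro ⟨hm, hb⟩
    have h01 : ∀ i : Fin (k + 1), 0 ≤ uExt u i.castSucc ∧ uExt u i.castSucc ≤ 1 := by
      intro i
      refine Fin.cases ?_ (fun j => ?_) i
      · simp [hzero]
      · rw [hval]
        exact hb j
    intro i j
    refine Fin.lastCases (fun h => ?_) (fun i h => ?_) i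
    · rw [Fin.last_le_iff.1 h]
    · revert h
      refine Fin.lastCases (fun _ => ?_) (fun j h => ?_) j
      · rw [hlast]
        exact (h01 i).2
      · revert h
        refine Fin.cases (fun _ => ?_) (fun i h => ?_) i
        · rw [Fin.castSucc_zero, hzero]
          exact (h01 j).1
        · revert h
          refine Fin.cases (fun h => ?_) (fun j h => ?_) j
          · exact absurd h (by simp)
          · rw [hval, hval]
            exact hm (by simpa using h)

lemma ofReal_osDensity (n k : ℕ) (ns : Fin k → Fin n) (u : Fin k → ℝ) :
    ENNReal.ofReal (osDensity n k ns u) =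
      n.factorial * chainDensity (gap n k ns) (uExt u) := by
  by_cases h : Monotone (uExt u)
  · have h' := (monotone_uExt_iff u).1 h
    rw [osDensity, if_pos ⟨fun i j hij => h'.1 hij, h'.2⟩, chainDensity_of_monotone _ h,
      ENNReal.ofReal_mul (Nat.cast_nonneg _), ENNReal.ofReal_natCast]
    rfl
  · have h' : ¬ ((∀ i j : Fin k, i ≤ j → u i ≤ u j) ∧ ∀ i, 0 ≤ u i ∧ u i ≤ 1) := fun h' =>
      h ((monotone_uExt_iff u).2 ⟨fun i j hij => h'.1 i j hij, h'.2⟩)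
    rw [osDensity, if_neg h', chainDensity_of_not_monotone _ h]
    simp

lemma ae_injective (n : ℕ) : ∀ᵐ u : Fin n → ℝ, Function.Injective u := by
  have h : ∀ i j : Fin n, i ≠ j → ∀ᵐ u : Fin n → ℝ, u i ≠ u j := by
    intro i j hij
    let L : (Fin n → ℝ) →ₗ[ℝ] ℝ := LinearMap.proj (R := ℝ) (φ := fun _ : Fin n => ℝ) i - LinearMap.proj j
    have hL : L.ker ≠ ⊤ := by
      intro hL
      have : (Pi.single i 1 : Fin n → ℝ) ∈ L.ker := hL ▸ Submodule.mem_top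
      simp [L, hij.symm] at this
    have h0 := Measure.addHaar_submodule (volume : Measure (Fin n → ℝ)) L.ker hL
    rw [ae_iff]
    convert h0 using 2
    ext u
    simp [L, sub_eq_zero]
  have h' : ∀ᵐ u : Fin n → ℝ, ∀ i j : Fin n, i ≠ j → u i ≠ u j := by
    simp only [ae_all_iff]
    exact h
  filter_upwards [h'] with u hu i j hij
  by_contra hne
  exact hu i j hne hij

lemma measurableSet_monotone (n : ℕ) : MeasurableSet {u : Fin n → ℝ | Monotone u} := by
  simp only [Monotone, Set.ofPred_forall]
  exact MeasurableSet.iInter fun i => MeasurableSet.iInter fun j => MeasurableSet.iInter fun _ =>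
    measurableSet_le (measurable_pi_apply i) (measurable_pi_apply j)

lemma measurable_orderStat (n : ℕ) : Measurable (orderStat n) := by
  let _ : MeasurableSpace (Equiv.Perm (Fin n)) := ⊤
  have hs : Measurable fun u : Fin n → ℝ => Tuple.sort u := by
    refine measurable_to_countable' fun σ => ?_
    have : (fun u : Fin n → ℝ => Tuple.sort u) ⁻¹' {σ} =
        {u | Monotone (u ∘ σ)} ∩
          {u | ∀ i j, i < j → u (σ i) = u (σ j) → σ i < σ j} := by
      ext u
      simp only [Set.mem_preimage, Set.mem_singleton_iff, Set.mem_inter_iff, Set.mem_ofPred_eq]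
      rw [eq_comm, Tuple.eq_sort_iff]
    rw [this]
    refine MeasurableSet.inter ?_ ?_
    · exact (measurable_pi_iff.2 fun i => measurable_pi_apply (σ i) :
        Measurable fun u : Fin n → ℝ => u ∘ σ) (measurableSet_monotone n)
    · simp only [Set.ofPred_forall]
      refine MeasurableSet.iInter fun i => MeasurableSet.iInter fun j =>
        MeasurableSet.iInter fun _ => MeasurableSet.imp ?_ (MeasurableSet.const _)
      exact measurableSet_eq_fun (measurable_pi_apply _) (measurable_pi_apply _)
  have hc : Measurable fun p : (Fin n → ℝ) × Equiv.Perm (Fin n) => p.1 ∘ p.2 :=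
    measurable_from_prod_countable_left fun σ => measurable_pi_iff.2 fun i =>
      measurable_pi_apply (σ i)
  exact hc.comp (measurable_id.prodMk hs)

theorem lintegral_comp_orderStat {n : ℕ} {F : (Fin n → ℝ) → ℝ≥0∞} (hF : Measurable F) :
    ∫⁻ u, F (orderStat n u) = n.factorial * ∫⁻ x in {x | Monotone x}, F x := by
  have hFi : Measurable ({x : Fin n → ℝ | Monotone x}.indicator F) :=
    hF.indicator (measurableSet_monotone n)
  have hσ : ∀ σ : Equiv.Perm (Fin n),
      MeasurePreserving (fun u : Fin n → ℝ => u ∘ σ) volume volume := fun σ =>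
    volume_preserving_arrowCongr' σ.symm (MeasurableEquiv.refl ℝ) (MeasurePreserving.id _)
  have hsum : ∀ᵐ u : Fin n → ℝ, F (orderStat n u) =
      ∑ σ : Equiv.Perm (Fin n), {x : Fin n → ℝ | Monotone x}.indicator F (u ∘ σ) := by
    filter_upwards [ae_injective n] with u hu
    rw [Finset.sum_eq_single (Tuple.sort u)]
    · rw [Set.indicator_of_mem (Tuple.monotone_sort u)]
      rfl
    · intro σ _ hne
      refine Set.indicator_of_notMem (fun hm => hne ?_) _
      have := Tuple.unique_monotone hm (Tuple.monotone_sort u)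
      exact Equiv.ext fun i => hu (congrFun this i)
    · simp
  have hmeas : ∀ σ : Equiv.Perm (Fin n), Measurable fun u : Fin n → ℝ =>
      {x : Fin n → ℝ | Monotone x}.indicator F (u ∘ σ) := fun σ => hFi.comp (hσ σ).measurable
  rw [lintegral_congr_ae hsum, lintegral_finsetSum _ fun σ _ => hmeas σ]
  simp_rw [fun σ : Equiv.Perm (Fin n) => (hσ σ).lintegral_comp hFi]
  rw [lintegral_indicator (measurableSet_monotone n)]
  simp [Fintype.card_perm]

/-- The joint law of the order statistics `(U_{n_1,n},…,U_{n_k,n})` of `n` i.i.d. uniforms on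
`[0,1]` (selected at the strictly increasing positions `ns`) is absolutely continuous with
respect to Lebesgue measure on `ℝ^k`, with density `osDensity`: the pushforward of the uniform
product measure on `[0,1]^n` under `u ↦ (sorted coordinates of u at positions ns)` equals
`osDensity · Lebesgue`. -/
theorem orderStat_marginal_density (n k : ℕ) (hk : 1 ≤ k) (hkn : k ≤ n)
    (ns : Fin k → Fin n) (hns : StrictMono ns) :
    Measure.map (fun u : Fin n → ℝ => fun i : Fin k => orderStat n u (ns i))
        (Measure.pi fun _ : Fin n => volume.restrict (Set.Icc (0 : ℝ) 1))
      = (volume : Measure (Fin k → ℝ)).withDensity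
          (fun u => ENNReal.ofReal (osDensity n k ns u)) := by
  have hmeas : Measurable fun u : Fin n → ℝ => fun i : Fin k => orderStat n u (ns i) :=
    measurable_pi_iff.2 fun i => (measurable_pi_apply (ns i)).comp (measurable_orderStat n)
  have hchain : ∀ {l : ℕ} (m : Fin (l + 1) → ℕ),
      Measurable fun u : Fin l → ℝ => chainDensity m (uExt u) := fun m => by
    simp only [uExt, ← Fin.cons_snoc_eq_snoc_cons]
    exact (measurable_chainDensity _).comp
      (measurable_cons.comp (measurable_const.prodMk measurable_snoc_one))
  have hcube : MeasurableSet (Set.univ.pi fun _ : Fin n => Set.Icc (0 : ℝ) 1) :=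
    MeasurableSet.univ_pi fun _ => measurableSet_Icc
  refine Measure.ext_of_lintegral _ fun G hG => ?_
  have hprod : Measurable fun y : Fin k → ℝ => G y * chainDensity (gap n k ns) (uExt y) :=
    hG.mul (hchain _)
  have hGn : Measurable fun x : Fin n → ℝ => G fun i => x (ns i) := by fun_prop
  simp_rw [ofReal_osDensity]
  rw [lintegral_map hG hmeas, ← Measure.restrict_pi_pi,
    lintegral_withDensity_eq_lintegral_mul _ ((hchain _).const_mul _) hG,
    ← lintegral_indicator hcube]
  calc ∫⁻ u : Fin n → ℝ, (Set.univ.pi fun _ : Fin n => Set.Icc (0 : ℝ) 1).indicator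
        (fun u => G fun i => orderStat n u (ns i)) u
      = ∫⁻ u : Fin n → ℝ, (Set.univ.pi fun _ : Fin n => Set.Icc (0 : ℝ) 1).indicator
        (fun x => G fun i => x (ns i)) (orderStat n u) := by
        refine lintegral_congr fun u => ?_
        have hiff : orderStat n u ∈ (Set.univ.pi fun _ : Fin n => Set.Icc (0 : ℝ) 1) ↔
            u ∈ Set.univ.pi fun _ : Fin n => Set.Icc (0 : ℝ) 1 := by
          simp only [Set.mem_univ_pi, orderStat, Function.comp_apply]
          exact (Tuple.sort u).forall_congr_right (q := fun i => u i ∈ Set.Icc (0 : ℝ) 1)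
        by_cases hu : u ∈ Set.univ.pi fun _ : Fin n => Set.Icc (0 : ℝ) 1
        · rw [Set.indicator_of_mem hu, Set.indicator_of_mem (hiff.2 hu)]
        · rw [Set.indicator_of_notMem hu, Set.indicator_of_notMem (mt hiff.1 hu)]
    _ = n.factorial * ∫⁻ x : Fin n → ℝ, G (fun i => x (ns i)) * chainDensity 0 (uExt x) := by
        rw [lintegral_comp_orderStat (hGn.indicator hcube),
          ← lintegral_indicator (measurableSet_monotone n)]
        congr 1
        refine lintegral_congr fun x => ?_
        rw [Set.indicator_indicator]
        have hiff : x ∈ {x | Monotone x} ∩ (Set.univ.pi fun _ : Fin n => Set.Icc (0 : ℝ) 1) ↔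
            Monotone (uExt x) := by
          simp only [monotone_uExt_iff, Set.mem_inter_iff, Set.mem_univ_pi, Set.mem_Icc]
          rfl
        by_cases hx : Monotone (uExt x)
        · rw [Set.indicator_of_mem (hiff.2 hx), chainDensity_of_monotone _ hx]
          simp
        · rw [Set.indicator_of_notMem (mt hiff.1 hx), chainDensity_of_not_monotone _ hx, mul_zero]
    _ = n.factorial * ∫⁻ y : Fin k → ℝ, G y * chainDensity (gap n k ns) (uExt y) := by
        simp only [uExt, ← Fin.cons_snoc_eq_snoc_cons]
        rw [lintegral_chainDensity_marginal n k ns hns 0 G hG]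
    _ = _ := by
        rw [← lintegral_const_mul _ hprod]
        refine lintegral_congr fun y => ?_
        simp only [Pi.mul_apply]
        ring
end
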